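/- Let M be a countable conical refinement monoid. Then there exist: a sequence of natural numbers r_j with monoid homomorphisms β_j : (ℤ₊)^{r_j} → (ℤ₊)^{r_{j+1}}; an additive commutative monoid Δ with monoid homomorphisms φ_j : (ℤ₊)^{r_j} → Δ making Δ the inductive limit of the sequence (β_j); and a surjective monoid homomorphism α : Δ → M such that for all x, y ∈ Δ, if α(x) ∝ α(y) in M then x ∝ y in Δ. -/

import Mathlib

/-- The algebraic preorder on an additive commutative monoid. -/
def AlgLE {M : Type*} [AddCommMonoid M] (x y : M) : Prop := ∃ z : M, x + z = y

/-- `x ∝ y` : `x ≤ n • y` for some natural number `n ≥ 1`. -/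
def Propto {M : Type*} [AddCommMonoid M] (x y : M) : Prop :=
  ∃ n : ℕ, 1 ≤ n ∧ AlgLE x (n • y)

/-- A refinement monoid. -/
def IsRefinement (M : Type*) [AddCommMonoid M] : Prop :=
  ∀ x₁ x₂ y₁ y₂ : M, x₁ + x₂ = y₁ + y₂ →
    ∃ z₁₁ z₁₂ z₂₁ z₂₂ : M,
      x₁ = z₁₁ + z₁₂ ∧ x₂ = z₂₁ + z₂₂ ∧ y₁ = z₁₁ + z₂₁ ∧ y₂ = z₁₂ + z₂₂

/-- A conical monoid: `x + y = 0` implies `x = y = 0`. -/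
def IsConical (M : Type*) [AddCommMonoid M] : Prop :=
  ∀ x y : M, x + y = 0 → x = 0 ∧ y = 0

/-- The composite `β_{j+k-1} ∘ ⋯ ∘ β_j : (ℤ₊)^{r_j} → (ℤ₊)^{r_{j+k}}` of the
connecting maps of a sequence of simplicial monoids. -/
def iterComp (r : ℕ → ℕ) (β : ∀ j : ℕ, (Fin (r j) → ℕ) →+ (Fin (r (j + 1)) → ℕ))
    (j : ℕ) : ∀ k : ℕ, (Fin (r j) → ℕ) →+ (Fin (r (j + k)) → ℕ)
  | 0 => AddMonoidHom.id _
  | k + 1 => (β (j + k)).comp (iterComp r β j k)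

/-- `Δ`, together with maps `φ_j : (ℤ₊)^{r_j} → Δ`, is the inductive limit of the
sequence of simplicial monoids `(ℤ₊)^{r_j}` along the connecting maps `β_j`.
A monoid arising in this way is a dimension monoid. -/
structure IsInductiveLimit (r : ℕ → ℕ)
    (β : ∀ j : ℕ, (Fin (r j) → ℕ) →+ (Fin (r (j + 1)) → ℕ))
    (Δ : Type*) [AddCommMonoid Δ] (φ : ∀ j : ℕ, (Fin (r j) → ℕ) →+ Δ) : Prop where
  comp_eq : ∀ j : ℕ, (φ (j + 1)).comp (β j) = φ j
  covers : ∀ d : Δ, ∃ (j : ℕ) (x : Fin (r j) → ℕ), φ j x = d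
  eventually_eq : ∀ (j : ℕ) (x y : Fin (r j) → ℕ), φ j x = φ j y →
    ∃ k : ℕ, iterComp r β j k x = iterComp r β j k y

section Preorder

variable {M N : Type*} [AddCommMonoid M] [AddCommMonoid N]

theorem AlgLE.propto {x y : M} (h : AlgLE x y) : Propto x y :=
  ⟨1, le_rfl, by rwa [one_nsmul]⟩

theorem Propto.trans {x y z : M} (hxy : Propto x y) (hyz : Propto y z) : Propto x z := by
  obtain ⟨m, hm, c, hc⟩ := hxy
  obtain ⟨n, hn, d, hd⟩ := hyz
  refine ⟨m * n, Nat.mul_pos hm hn, c + m • d, ?_⟩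
  rw [← add_assoc, hc, ← nsmul_add, hd, mul_nsmul']

theorem Propto.add {x y z : M} (hx : Propto x z) (hy : Propto y z) : Propto (x + y) z := by
  obtain ⟨m, hm, c, hc⟩ := hx
  obtain ⟨n, hn, d, hd⟩ := hy
  refine ⟨m + n, by omega, c + d, ?_⟩
  rw [add_add_add_comm, hc, hd, add_nsmul]

theorem Propto.zero (z : M) : Propto 0 z :=
  AlgLE.propto ⟨z, zero_add z⟩

theorem Propto.nsmul {x z : M} (hx : Propto x z) (n : ℕ) : Propto (n • x) z := by
  induction n with
  | zero => rw [zero_nsmul]; exact Propto.zero z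
  | succ n ih => rw [succ_nsmul]; exact ih.add hx

theorem Propto.sum {ι : Type*} {s : Finset ι} {x : ι → M} {z : M}
    (h : ∀ i ∈ s, Propto (x i) z) : Propto (∑ i ∈ s, x i) z :=
  Finset.sum_induction x (Propto · z) (fun _ _ => Propto.add) (Propto.zero z) h

theorem Propto.map {x y : M} (f : M →+ N) (h : Propto x y) : Propto (f x) (f y) := by
  obtain ⟨n, hn, c, hc⟩ := h
  exact ⟨n, hn, f c, by rw [← map_add, hc, map_nsmul]⟩

/-- The Riesz decomposition property of conical refinement monoids. -/
theorem exists_sum_eq_of_algLE_sum (hC : IsConical M) (hR : IsRefinement M) {ι : Type*}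
    [DecidableEq ι] (s : Finset ι) (b : ι → M) (z : M) (h : AlgLE z (∑ i ∈ s, b i)) :
    ∃ z' : ι → M, (∀ i, AlgLE (z' i) (b i)) ∧ ∑ i ∈ s, z' i = z := by
  induction s using Finset.induction_on generalizing z with
  | empty =>
    obtain ⟨c, hc⟩ := h
    exact ⟨0, fun i => ⟨b i, zero_add _⟩, by simpa using (hC z c hc).1.symm⟩
  | insert i s hi ih =>
    obtain ⟨c, hc⟩ := h
    rw [Finset.sum_insert hi] at hc
    obtain ⟨p, q, p', q', rfl, rfl, hb, hs⟩ := hR _ _ _ _ hc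
    obtain ⟨z', hz', hsum⟩ := ih q ⟨q', hs.symm⟩
    refine ⟨Function.update z' i p, fun j => ?_, ?_⟩
    · by_cases hj : j = i
      · subst hj
        rw [Function.update_self]
        exact ⟨p', hb.symm⟩
      · rw [Function.update_of_ne hj]
        exact hz' j
    · rw [Finset.sum_insert hi, Function.update_self, Finset.sum_update_of_notMem hi, hsum]

end Preorder

section Simplicial

variable {M : Type*} [AddCommMonoid M] {r : ℕ}

/-- The homomorphism out of a simplicial monoid with prescribed values on the basis. -/
def basisHom (v : Fin r → M) : (Fin r → ℕ) →+ M :=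
  (Fintype.linearCombination ℕ v).toAddMonoidHom

theorem basisHom_apply (v : Fin r → M) (x : Fin r → ℕ) : basisHom v x = ∑ i, x i • v i :=
  rfl

theorem basisHom_single (v : Fin r → M) (i : Fin r) : basisHom v (Pi.single i 1) = v i := by
  simp [basisHom_apply, Pi.single_apply]

theorem map_eq_sum_single (f : (Fin r → ℕ) →+ M) (x : Fin r → ℕ) :
    f x = ∑ i, x i • f (Pi.single i 1) := by
  have h : basisHom (fun i => f (Pi.single i 1)) = f :=
    AddMonoidHom.functions_ext _ _ _ fun i n => by
      rw [← mul_one n, ← smul_eq_mul, Pi.single_smul', map_nsmul, map_nsmul, basisHom_single]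
  rw [← basisHom_apply, h]

theorem simplicial_hom_ext {f g : (Fin r → ℕ) →+ M}
    (h : ∀ i, f (Pi.single i 1) = g (Pi.single i 1)) : f = g := by
  refine DFunLike.ext _ _ fun x => ?_
  rw [map_eq_sum_single f, map_eq_sum_single g]
  simp [h]

theorem propto_of_support_subset {x y : Fin r → ℕ} (h : ∀ i, x i ≠ 0 → y i ≠ 0) :
    Propto x y := by
  refine ⟨∑ i, x i + 1, by omega, (∑ i, x i + 1) • y - x, ?_⟩
  refine add_tsub_cancel_of_le fun i => ?_
  by_cases hx : x i = 0
  · simp [hx]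
  · have h1 : x i ≤ ∑ i, x i := Finset.single_le_sum (fun _ _ => Nat.zero_le _) (Finset.mem_univ i)
    have h2 : 1 ≤ y i := Nat.one_le_iff_ne_zero.mpr (h i hx)
    simp only [Pi.smul_apply, smul_eq_mul]
    nlinarith

/-- The `0`-`1` vector with the same support as `x`. -/
def supportIndicator (x : Fin r → ℕ) : Fin r → ℕ := fun i => if x i = 0 then 0 else 1

theorem supportIndicator_le_one (x : Fin r → ℕ) (i : Fin r) : supportIndicator x i ≤ 1 := by
  unfold supportIndicator; split <;> simp

theorem supportIndicator_propto (x : Fin r → ℕ) : Propto (supportIndicator x) x :=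
  propto_of_support_subset fun i => by simp [supportIndicator]

theorem propto_supportIndicator (x : Fin r → ℕ) : Propto x (supportIndicator x) :=
  propto_of_support_subset fun i => by simp [supportIndicator]

end Simplicial

section Extension

variable {M : Type*} [AddCommMonoid M] {r : ℕ}

theorem exists_split_of_algLE (hC : IsConical M) (hR : IsRefinement M)
    (α : (Fin r → ℕ) →+ M) (y : Fin r → ℕ) (hy : ∀ i, y i ≤ 1) (z : M) (hz : AlgLE z (α y)) :
    ∃ (s : ℕ) (β : (Fin r → ℕ) →+ (Fin s → ℕ)) (α' : (Fin s → ℕ) →+ M) (w : Fin s → ℕ),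
      α'.comp β = α ∧ (∀ i, β y i ≤ 1) ∧ α' w = z ∧ Propto w (β y) := by
  rw [map_eq_sum_single α] at hz
  obtain ⟨z', hz', rfl⟩ := exists_sum_eq_of_algLE_sum hC hR _ _ _ hz
  have hc : ∀ i, ∃ c, z' i + c = α (Pi.single i 1) ∧ y i • z' i = z' i := by
    intro i
    obtain ⟨c, hc⟩ := hz' i
    obtain h | h : y i = 0 ∨ y i = 1 := by have := hy i; omega
    · rw [h, zero_nsmul] at hc
      exact ⟨α (Pi.single i 1), by simp [(hC _ _ hc).1]⟩
    · rw [h, one_nsmul] at hc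
      exact ⟨c, hc, by simp [h]⟩
  choose c hc hyz using hc
  let β : (Fin r → ℕ) →+ (Fin (r + r) → ℕ) :=
    { toFun := fun x => Fin.append x x
      map_zero' := by
        ext i; refine Fin.addCases (fun i => ?_) (fun i => ?_) i <;> simp [-Fin.natAdd_eq_addNat]
      map_add' := fun x x' => by
        ext i; refine Fin.addCases (fun i => ?_) (fun i => ?_) i <;> simp [-Fin.natAdd_eq_addNat] }
  have hβ : ∀ x, β x = Fin.append x x := fun _ => rfl
  refine ⟨r + r, β, basisHom (Fin.append z' c), Fin.append y 0, ?_, ?_, ?_, ?_⟩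
  · refine DFunLike.ext _ _ fun x => ?_
    rw [AddMonoidHom.comp_apply, hβ, basisHom_apply, Fin.sum_univ_add, map_eq_sum_single α,
      ← Finset.sum_add_distrib]
    simp [← hc, -Fin.natAdd_eq_addNat]
  · intro i
    rw [hβ]
    refine Fin.addCases (fun i => ?_) (fun i => ?_) i <;> simpa [-Fin.natAdd_eq_addNat] using hy i
  · rw [basisHom_apply, Fin.sum_univ_add]
    simp [hyz, -Fin.natAdd_eq_addNat]
  · rw [hβ]
    refine propto_of_support_subset fun i => ?_
    refine Fin.addCases (fun i => ?_) (fun i => ?_) i <;> simp [-Fin.natAdd_eq_addNat]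

theorem exists_lift_of_propto (hC : IsConical M) (hR : IsRefinement M)
    (α : (Fin r → ℕ) →+ M) (y : Fin r → ℕ) (hy : ∀ i, y i ≤ 1) (z : M) (hz : Propto z (α y)) :
    ∃ (s : ℕ) (β : (Fin r → ℕ) →+ (Fin s → ℕ)) (α' : (Fin s → ℕ) →+ M) (w : Fin s → ℕ),
      α'.comp β = α ∧ (∀ i, β y i ≤ 1) ∧ α' w = z ∧ Propto w (β y) := by
  obtain ⟨n, -, hz⟩ := hz
  induction n generalizing z with
  | zero =>
    obtain ⟨c, hc⟩ := hz
    rw [zero_nsmul] at hc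
    exact ⟨r, AddMonoidHom.id _, α, 0, rfl, hy, by rw [map_zero, (hC _ _ hc).1], Propto.zero _⟩
  | succ n ih =>
    obtain ⟨c, hc⟩ := hz
    rw [succ_nsmul] at hc
    obtain ⟨z₁, z₂, c₁, c₂, rfl, rfl, h₁, h₂⟩ := hR _ _ _ _ hc
    obtain ⟨s, β, α', w, rfl, hβy, rfl, hw⟩ := ih z₁ ⟨c₁, h₁.symm⟩
    obtain ⟨t, γ, α'', v, rfl, hγy, rfl, hv⟩ :=
      exists_split_of_algLE hC hR α' (β y) hβy z₂ ⟨c₂, h₂.symm⟩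
    exact ⟨t, γ.comp β, α'', γ w + v, rfl, hγy, map_add _ _ _, (hw.map γ).add hv⟩

theorem exists_lift_family_of_propto (hC : IsConical M) (hR : IsRefinement M)
    (α : (Fin r → ℕ) →+ M) (y : Fin r → ℕ) (hy : ∀ i, y i ≤ 1) {ι : Type*} [DecidableEq ι]
    (I : Finset ι) (z : ι → M) (hz : ∀ i ∈ I, Propto (z i) (α y)) :
    ∃ (s : ℕ) (β : (Fin r → ℕ) →+ (Fin s → ℕ)) (α' : (Fin s → ℕ) →+ M) (w : ι → Fin s → ℕ),
      α'.comp β = α ∧ (∀ i, β y i ≤ 1) ∧ ∀ i ∈ I, α' (w i) = z i ∧ Propto (w i) (β y) := by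
  induction I using Finset.induction_on with
  | empty => exact ⟨r, AddMonoidHom.id _, α, 0, rfl, hy, by simp⟩
  | insert i I hi ih =>
    obtain ⟨s, β, α', w, rfl, hβy, hw⟩ := ih fun j hj => hz j (Finset.mem_insert_of_mem hj)
    obtain ⟨t, γ, α'', v, rfl, hγy, hvz, hv⟩ :=
      exists_lift_of_propto hC hR α' (β y) hβy (z i) (hz i (Finset.mem_insert_self i I))
    refine ⟨t, γ.comp β, α'', Function.update (fun j => γ (w j)) i v, rfl, hγy, fun j hj => ?_⟩
    by_cases hji : j = i
    · subst hji
      rw [Function.update_self]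
      exact ⟨hvz, hv⟩
    · rw [Function.update_of_ne hji]
      obtain ⟨h₁, h₂⟩ := hw j (Finset.mem_of_mem_insert_of_ne hj hji)
      exact ⟨h₁, h₂.map γ⟩

theorem exists_extension_reflecting_of_le_one (hC : IsConical M) (hR : IsRefinement M)
    (α : (Fin r → ℕ) →+ M) (y : Fin r → ℕ) (hy : ∀ i, y i ≤ 1) :
    ∃ (s : ℕ) (β : (Fin r → ℕ) →+ (Fin s → ℕ)) (α' : (Fin s → ℕ) →+ M),
      α'.comp β = α ∧ ∀ x, Propto (α x) (α y) → Propto (β x) (β y) := by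
  classical
  let I : Finset (Fin r) := {i | y i = 0 ∧ Propto (α (Pi.single i 1)) (α y)}
  obtain ⟨s, β, α', w, hα, -, hw⟩ := exists_lift_family_of_propto hC hR α y hy I
    (fun i => α (Pi.single i 1)) fun i hi => (Finset.mem_filter.mp hi).2.2
  let γ := basisHom fun i => if i ∈ I then w i else β (Pi.single i 1)
  have hγI : ∀ i ∈ I, γ (Pi.single i 1) = w i := fun i hi => by
    simp only [γ, basisHom_single, if_pos hi]
  have hγ : ∀ i ∉ I, γ (Pi.single i 1) = β (Pi.single i 1) := fun i hi => by
    simp only [γ, basisHom_single, if_neg hi]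
  have hγy : γ y = β y := by
    rw [map_eq_sum_single γ, map_eq_sum_single β]
    refine Finset.sum_congr rfl fun i _ => ?_
    by_cases hi : i ∈ I
    · rw [(Finset.mem_filter.mp hi).2.1, zero_nsmul, zero_nsmul]
    · rw [hγ i hi]
  refine ⟨s, γ, α', simplicial_hom_ext fun i => ?_, fun x hx => ?_⟩
  · rw [AddMonoidHom.comp_apply]
    by_cases hi : i ∈ I
    · rw [hγI i hi, (hw i hi).1]
    · rw [hγ i hi, ← hα, AddMonoidHom.comp_apply]
  · rw [map_eq_sum_single γ x]
    refine Propto.sum fun i _ => ?_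
    by_cases hxi : x i = 0
    · rw [hxi, zero_nsmul]
      exact Propto.zero _
    refine Propto.nsmul ?_ _
    by_cases hyi : y i = 0
    · have hi : i ∈ I := by
        refine Finset.mem_filter.mpr ⟨Finset.mem_univ i, hyi, Propto.trans ?_ hx⟩
        refine (propto_of_support_subset fun j hj => ?_).map α
        obtain rfl : j = i := by
          by_contra h
          exact hj (Pi.single_eq_of_ne h 1)
        exact hxi
      rw [hγI i hi, hγy]
      exact (hw i hi).2
    · refine (propto_of_support_subset fun j hj => ?_).map γ
      obtain rfl : j = i := by
        by_contra h
        exact hj (Pi.single_eq_of_ne h 1)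
      exact hyi

theorem exists_extension_reflecting_single (hC : IsConical M) (hR : IsRefinement M)
    (α : (Fin r → ℕ) →+ M) (y : Fin r → ℕ) :
    ∃ (s : ℕ) (β : (Fin r → ℕ) →+ (Fin s → ℕ)) (α' : (Fin s → ℕ) →+ M),
      α'.comp β = α ∧ ∀ x, Propto (α x) (α y) → Propto (β x) (β y) := by
  obtain ⟨s, β, α', h, hβ⟩ := exists_extension_reflecting_of_le_one hC hR α (supportIndicator y)
    (supportIndicator_le_one y)
  exact ⟨s, β, α', h, fun x hx => (hβ x (hx.trans ((propto_supportIndicator y).map α))).trans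
    ((supportIndicator_propto y).map β)⟩

theorem exists_extension_reflecting_finset (hC : IsConical M) (hR : IsRefinement M)
    (α : (Fin r → ℕ) →+ M) (Y : Finset (Fin r → ℕ)) :
    ∃ (s : ℕ) (β : (Fin r → ℕ) →+ (Fin s → ℕ)) (α' : (Fin s → ℕ) →+ M),
      α'.comp β = α ∧ ∀ y ∈ Y, ∀ x, Propto (α x) (α y) → Propto (β x) (β y) := by
  induction Y using Finset.induction_on with
  | empty => exact ⟨r, AddMonoidHom.id _, α, rfl, by simp⟩
  | insert y Y hy ih =>
    obtain ⟨s, β, α', rfl, hβ⟩ := ih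
    obtain ⟨t, γ, α'', rfl, hγ⟩ := exists_extension_reflecting_single hC hR α' (β y)
    refine ⟨t, γ.comp β, α'', rfl, fun y' hy' x hx => ?_⟩
    obtain rfl | hy' := Finset.mem_insert.mp hy'
    · exact hγ (β x) hx
    · exact (hβ y' hy' x hx).map γ

theorem exists_extension_reflecting (hC : IsConical M) (hR : IsRefinement M)
    (α : (Fin r → ℕ) →+ M) :
    ∃ (s : ℕ) (β : (Fin r → ℕ) →+ (Fin s → ℕ)) (α' : (Fin s → ℕ) →+ M),
      α'.comp β = α ∧ ∀ x y, Propto (α x) (α y) → Propto (β x) (β y) := by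
  obtain ⟨s, β, α', h, hβ⟩ := exists_extension_reflecting_finset hC hR α
    (Finset.Iic fun _ => 1)
  refine ⟨s, β, α', h, fun x y hx => ?_⟩
  exact (hβ (supportIndicator y) (Finset.mem_Iic.mpr (supportIndicator_le_one y)) x
    (hx.trans ((propto_supportIndicator y).map α))).trans ((supportIndicator_propto y).map β)

theorem exists_extension_reflecting_mem_range (hC : IsConical M) (hR : IsRefinement M)
    (α : (Fin r → ℕ) →+ M) (m : M) :
    ∃ (s : ℕ) (β : (Fin r → ℕ) →+ (Fin s → ℕ)) (α' : (Fin s → ℕ) →+ M),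
      α'.comp β = α ∧ (∃ x, α' x = m) ∧ ∀ x y, Propto (α x) (α y) → Propto (β x) (β y) := by
  let γ : (Fin r → ℕ) →+ (Fin (r + 1) → ℕ) := basisHom fun i => Pi.single i.succ 1
  let δ : (Fin (r + 1) → ℕ) →+ M := basisHom (Fin.cons m fun i => α (Pi.single i 1))
  have hδγ : δ.comp γ = α := simplicial_hom_ext fun i => by
    simp only [γ, δ, AddMonoidHom.comp_apply, basisHom_single, Fin.cons_succ]
  obtain ⟨s, β, α', hα', hβ⟩ := exists_extension_reflecting hC hR δ
  refine ⟨s, β.comp γ, α', by rw [← AddMonoidHom.comp_assoc, hα', hδγ],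
    ⟨β (Pi.single 0 1), ?_⟩, fun x y h => hβ _ _ ?_⟩
  · rw [← AddMonoidHom.comp_apply, hα']
    exact basisHom_single _ _
  · rwa [← AddMonoidHom.comp_apply, ← AddMonoidHom.comp_apply, hδγ]

theorem exists_reflecting_sequence [Countable M] (hC : IsConical M) (hR : IsRefinement M) :
    ∃ (r : ℕ → ℕ) (β : ∀ j : ℕ, (Fin (r j) → ℕ) →+ (Fin (r (j + 1)) → ℕ))
      (a : ∀ j : ℕ, (Fin (r j) → ℕ) →+ M),
      (∀ j, (a (j + 1)).comp (β j) = a j) ∧ (∀ m, ∃ j x, a j x = m) ∧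
        ∀ j x y, Propto (a j x) (a j y) → Propto (β j x) (β j y) := by
  obtain ⟨e, he⟩ := exists_surjective_nat M
  choose s β α' h₁ h₂ h₃ using
    fun p : Σ r : ℕ, (Fin r → ℕ) →+ M => exists_extension_reflecting_mem_range hC hR p.2
  let st : ℕ → Σ r : ℕ, (Fin r → ℕ) →+ M :=
    fun n => Nat.rec ⟨0, 0⟩ (fun k p => ⟨s p (e k), α' p (e k)⟩) n
  refine ⟨fun j => (st j).1, fun j => β (st j) (e j), fun j => (st j).2,
    fun j => h₁ (st j) (e j), fun m => ?_, fun j => h₃ (st j) (e j)⟩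
  obtain ⟨j, rfl⟩ := he m
  exact ⟨j + 1, h₂ (st j) (e j)⟩

end Extension

section Limit

variable (r : ℕ → ℕ) (β : ∀ j : ℕ, (Fin (r j) → ℕ) →+ (Fin (r (j + 1)) → ℕ))

/-- The transition map `(ℤ₊)^{r_i} → (ℤ₊)^{r_j}` for `i ≤ j`. -/
def transitionHom (i j : ℕ) (h : i ≤ j) : (Fin (r i) → ℕ) →+ (Fin (r j) → ℕ) :=
  Nat.leRec (motive := fun k _ => (Fin (r i) → ℕ) →+ (Fin (r k) → ℕ)) (AddMonoidHom.id _)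
    (fun k _ f => (β k).comp f) h

theorem transitionHom_self (i : ℕ) : transitionHom r β i i le_rfl = AddMonoidHom.id _ :=
  Nat.leRec_self _ _

theorem transitionHom_succ (i j : ℕ) (h : i ≤ j) :
    transitionHom r β i (j + 1) (h.trans j.le_succ) = (β j).comp (transitionHom r β i j h) :=
  Nat.leRec_succ _ _ h

theorem transitionHom_add (j k : ℕ) :
    transitionHom r β j (j + k) (Nat.le_add_right j k) = iterComp r β j k := by
  induction k with
  | zero => exact transitionHom_self r β j
  | succ k ih =>
    rw [iterComp, ← ih]
    exact transitionHom_succ r β j (j + k) _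

instance transitionHom_directedSystem :
    DirectedSystem (fun j => Fin (r j) → ℕ) (transitionHom r β · · ·) where
  map_self i x := by rw [transitionHom_self, AddMonoidHom.id_apply]
  map_map k j i hij hjk x := by
    induction k, hjk using Nat.le_induction with
    | base => rw [transitionHom_self, AddMonoidHom.id_apply]
    | succ k hjk ih =>
      rw [transitionHom_succ r β j k hjk, transitionHom_succ r β i k (hij.trans hjk)]
      simp only [AddMonoidHom.comp_apply]
      rw [ih]

/-- The canonical map from a stage of the sequence to its direct limit. -/
noncomputable def toLimit (j : ℕ) :
    (Fin (r j) → ℕ) →+ DirectLimit (fun j => Fin (r j) → ℕ) (transitionHom r β) where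
  toFun x := ⟦⟨j, x⟩⟧
  map_zero' := (DirectLimit.zero_def (f := transitionHom r β) j).symm
  map_add' x y := (DirectLimit.add_def (f := transitionHom r β) j x y).symm

theorem toLimit_isInductiveLimit :
    IsInductiveLimit r β (DirectLimit (fun j => Fin (r j) → ℕ) (transitionHom r β))
      (toLimit r β) where
  comp_eq j := by
    refine DFunLike.ext _ _ fun x => ?_
    have h : transitionHom r β j (j + 1) j.le_succ x = β j x := by
      rw [transitionHom_succ r β j j le_rfl, transitionHom_self]
      rfl
    rw [AddMonoidHom.comp_apply, ← h]
    exact DirectLimit.mk_apply (f := transitionHom r β) j (j + 1) x j.le_succ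
  covers d := by
    obtain ⟨j, x, rfl⟩ := DirectLimit.exists_eq_mk _ d
    exact ⟨j, x, rfl⟩
  eventually_eq j x y h := by
    obtain ⟨i, hi, _, hxy⟩ := Quotient.exact h
    obtain ⟨k, rfl⟩ := Nat.exists_eq_add_of_le hi
    refine ⟨k, ?_⟩
    rw [← transitionHom_add]
    exact hxy

theorem exists_limit_hom {M : Type*} [AddCommMonoid M] (a : ∀ j : ℕ, (Fin (r j) → ℕ) →+ M)
    (ha : ∀ j, (a (j + 1)).comp (β j) = a j) :
    ∃ α : DirectLimit (fun j => Fin (r j) → ℕ) (transitionHom r β) →+ M,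
      ∀ j x, α (toLimit r β j x) = a j x := by
  have compat : ∀ i j h x, a i x = a j (transitionHom r β i j h x) := by
    intro i j h x
    induction j, h using Nat.le_induction with
    | base => rw [transitionHom_self, AddMonoidHom.id_apply]
    | succ j h ih =>
      rw [transitionHom_succ r β i j h, ih, ← ha j]
      rfl
  exact ⟨{ toFun := DirectLimit.lift (transitionHom r β) (a · ·) compat
           map_zero' := DirectLimit.lift_zero a compat
           map_add' := DirectLimit.lift_add a compat }, fun _ _ => rfl⟩

end Limit

theorem stmt_9 {M : Type*} [AddCommMonoid M] [Countable M]
    (hC : IsConical M) (hR : IsRefinement M) :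
    ∃ (r : ℕ → ℕ) (β : ∀ j : ℕ, (Fin (r j) → ℕ) →+ (Fin (r (j + 1)) → ℕ))
      (Δ : Type) (_ : AddCommMonoid Δ),
      ∃ (φ : ∀ j : ℕ, (Fin (r j) → ℕ) →+ Δ) (α : Δ →+ M),
        IsInductiveLimit r β Δ φ ∧
        Function.Surjective α ∧
        ∀ x y : Δ, Propto (α x) (α y) → Propto x y := by
  obtain ⟨r, β, a, ha, hsurj, hrefl⟩ := exists_reflecting_sequence hC hR
  obtain ⟨α, hα⟩ := exists_limit_hom r β a ha
  have hlim := toLimit_isInductiveLimit r β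
  refine ⟨r, β, _, inferInstance, toLimit r β, α, hlim, fun m => ?_, fun x y hxy => ?_⟩
  · obtain ⟨j, x, rfl⟩ := hsurj m
    exact ⟨toLimit r β j x, hα j x⟩
  · obtain ⟨j, x, y, rfl, rfl⟩ := DirectLimit.exists_eq_mk₂ _ x y
    have h := (hrefl j x y (by rwa [← hα, ← hα])).map (toLimit r β (j + 1))
    rwa [← AddMonoidHom.comp_apply, ← AddMonoidHom.comp_apply, hlim.comp_eq] at h
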